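/- arXiv:1712.00536 — 4 statements merged into one kernel-verified Lean document; each statement's English description precedes it below -/
import Mathlib

section
/- For every θ ∈ ℝ^n, the Lipschitz constant L₁(z, θ) = ρ ‖(D Eᵀ E D) ∘ (sin(Eᵀθ) sin(Eᵀθ)ᵀ)‖ of the partial gradient ∇_γ H_ρ satisfies the uniform bound L₁(z, θ) ≤ ρ m ‖E D‖², where ∘ is the entrywise (Hadamard) product and ‖·‖ applied to a matrix denotes its largest singular value (spectral norm). -/
open scoped Matrix

/-- The spectral norm (largest singular value) of a real matrix, as the operator norm of
the induced linear map between Euclidean spaces. -/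
noncomputable def specNorm {a b : ℕ} (A : Matrix (Fin a) (Fin b) ℝ) : ℝ :=
  ‖LinearMap.toContinuousLinearMap (Matrix.toEuclideanLin A)‖

open scoped Matrix.Norms.L2Operator in
/-- The Hadamard product with a rank-one matrix is a two-sided diagonal scaling, so the spectral
norm grows at most by the sup norms of the two factors. -/
theorem specNorm_hadamard_vecMulVec_le {a b : ℕ} (A : Matrix (Fin a) (Fin b) ℝ)
    (u : Fin a → ℝ) (v : Fin b → ℝ) :
    specNorm (A ⊙ Matrix.vecMulVec u v) ≤ ‖u‖ * specNorm A * ‖v‖ := by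
  have h : A ⊙ Matrix.vecMulVec u v = Matrix.diagonal u * A * Matrix.diagonal v := by
    ext i j
    simp only [Matrix.hadamard_apply, Matrix.vecMulVec_apply, Matrix.mul_diagonal,
      Matrix.diagonal_mul]
    ring
  change ‖A ⊙ Matrix.vecMulVec u v‖ ≤ ‖u‖ * ‖A‖ * ‖v‖
  rw [h, ← Matrix.l2_opNorm_diagonal u, ← Matrix.l2_opNorm_diagonal v]
  exact (Matrix.l2_opNorm_mul _ _).trans (by gcongr; exact Matrix.l2_opNorm_mul _ _)

open scoped Matrix.Norms.L2Operator in
theorem specNorm_transpose_mul_self {a b : ℕ} (A : Matrix (Fin a) (Fin b) ℝ) :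
    specNorm (Aᵀ * A) = specNorm A ^ 2 := by
  change ‖Aᵀ * A‖ = ‖A‖ ^ 2
  rw [← Matrix.conjTranspose_eq_transpose_of_trivial, Matrix.l2_opNorm_conjTranspose_mul_self, sq]

/-- The Lipschitz constant `L₁(z, θ) = ρ ‖(D Eᵀ E D) ∘ (sin(Eᵀθ) sin(Eᵀθ)ᵀ)‖` of the
partial gradient `∇_γ H_ρ` satisfies the uniform bound `L₁(z, θ) ≤ ρ m ‖E D‖²`. -/
theorem L1_uniform_bound {n m : ℕ} (E : Matrix (Fin n) (Fin m) ℝ)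
    (D : Matrix (Fin m) (Fin m) ℝ) (hD : D.IsDiag) (ρ : ℝ) (hρ : 0 < ρ) :
    ∀ θ : Fin n → ℝ,
      ρ * specNorm ((D * Eᵀ * E * D) ⊙
          Matrix.vecMulVec (fun l => Real.sin (Eᵀ.mulVec θ l))
            (fun l => Real.sin (Eᵀ.mulVec θ l))) ≤
        ρ * m * specNorm (E * D) ^ 2 := by
  intro θ
  have hfac : D * Eᵀ * E * D = (E * D)ᵀ * (E * D) := by
    rw [Matrix.transpose_mul, hD.isSymm.eq]
    simp only [Matrix.mul_assoc]
  set s : Fin m → ℝ := fun l => Real.sin (Eᵀ.mulVec θ l)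
  have hs : ‖s‖ ≤ 1 := (pi_norm_le_iff_of_nonneg zero_le_one).2 fun l => by
    rw [Real.norm_eq_abs]
    exact Real.abs_sin_le_one _
  have hsm : ‖s‖ ≤ m := by
    rcases m.eq_zero_or_pos with rfl | hm
    · simp [Subsingleton.elim s 0]
    · exact hs.trans (by exact_mod_cast hm)
  rw [hfac, mul_assoc ρ]
  gcongr
  calc specNorm (((E * D)ᵀ * (E * D)) ⊙ Matrix.vecMulVec s s)
      ≤ ‖s‖ * specNorm (E * D) ^ 2 * ‖s‖ := by
        rw [← specNorm_transpose_mul_self]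
        exact specNorm_hadamard_vecMulVec_le _ s s
    _ ≤ m * specNorm (E * D) ^ 2 * 1 := by gcongr
    _ = m * specNorm (E * D) ^ 2 := mul_one _
end

section
/- Let γ ∈ {0,1}^m and let z ∈ ℝ^n satisfy the feasibility bounds |P_i + z_i| ≤ |P_i| for all i (which hold under the load-shedding box constraints). Write Γ = diag(γ), Q = Γ D Eᵀ E D Γ and R = Γ D Eᵀ (P + z). Then 2‖Q‖ + ‖R‖₂ ≤ 2‖E D‖² + ‖E D‖ ‖P‖₂, and hence the Lipschitz constant L₃(γ, z) = ρ ‖E‖² (2‖Q‖ + ‖R‖₂) of ∇_θ H_ρ satisfies the uniform bound L₃(γ, z) ≤ ρ ‖E‖² (2‖E D‖² + ‖E D‖ ‖P‖₂). -/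
open scoped Matrix

/-- The Euclidean norm of a vector in `ℝ^k`. -/
noncomputable def evnorm {k : ℕ} (v : Fin k → ℝ) : ℝ :=
  ‖(WithLp.equiv 2 (Fin k → ℝ)).symm v‖

section SpectralNorm

open scoped Matrix.Norms.L2Operator

theorem specNorm_eq_l2_opNorm {a b : ℕ} (A : Matrix (Fin a) (Fin b) ℝ) : specNorm A = ‖A‖ :=
  rfl

theorem specNorm_nonneg {a b : ℕ} (A : Matrix (Fin a) (Fin b) ℝ) : 0 ≤ specNorm A :=
  norm_nonneg _

theorem specNorm_mul_le {a b c : ℕ} (A : Matrix (Fin a) (Fin b) ℝ)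
    (B : Matrix (Fin b) (Fin c) ℝ) : specNorm (A * B) ≤ specNorm A * specNorm B :=
  Matrix.l2_opNorm_mul A B

theorem specNorm_transpose {a b : ℕ} (A : Matrix (Fin a) (Fin b) ℝ) :
    specNorm Aᵀ = specNorm A := by
  simpa only [specNorm_eq_l2_opNorm, Matrix.conjTranspose_eq_transpose_of_trivial] using
    Matrix.l2_opNorm_conjTranspose A

theorem evnorm_mulVec_le {a b : ℕ} (A : Matrix (Fin a) (Fin b) ℝ) (v : Fin b → ℝ) :
    evnorm (A *ᵥ v) ≤ specNorm A * evnorm v :=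
  Matrix.l2_opNorm_mulVec A (WithLp.toLp 2 v)

theorem specNorm_diagonal_le_one {k : ℕ} {d : Fin k → ℝ} (hd : ∀ i, |d i| ≤ 1) :
    specNorm (Matrix.diagonal d) ≤ 1 := by
  rw [specNorm_eq_l2_opNorm, Matrix.l2_opNorm_diagonal]
  exact (pi_norm_le_iff_of_nonneg zero_le_one).2 hd

end SpectralNorm

theorem evnorm_le_evnorm {k : ℕ} {v w : Fin k → ℝ} (h : ∀ i, |v i| ≤ |w i|) :
    evnorm v ≤ evnorm w := by
  simp only [evnorm, EuclideanSpace.norm_eq]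
  gcongr with i
  exact h i

theorem specNorm_mul_diagonal_le {a b : ℕ} (A : Matrix (Fin a) (Fin b) ℝ) {d : Fin b → ℝ}
    (hd : ∀ i, |d i| ≤ 1) : specNorm (A * Matrix.diagonal d) ≤ specNorm A :=
  (specNorm_mul_le A _).trans <|
    mul_le_of_le_one_right (specNorm_nonneg A) (specNorm_diagonal_le_one hd)

/-- For `γ ∈ {0,1}^m` and feasible `z` (with `|P_i + z_i| ≤ |P_i|`), writing `Γ = diag(γ)`,
`Q = Γ D Eᵀ E D Γ` and `R = Γ D Eᵀ (P + z)`, one has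
`2‖Q‖ + ‖R‖₂ ≤ 2‖E D‖² + ‖E D‖‖P‖₂`, and hence the Lipschitz constant
`L₃(γ, z) = ρ ‖E‖² (2‖Q‖ + ‖R‖₂)` of `∇_θ H_ρ` satisfies
`L₃(γ, z) ≤ ρ ‖E‖² (2‖E D‖² + ‖E D‖‖P‖₂)`. -/
theorem L3_uniform_bound {n m : ℕ} (E : Matrix (Fin n) (Fin m) ℝ)
    (D : Matrix (Fin m) (Fin m) ℝ) (hD : D.IsDiag) (P : Fin n → ℝ) (ρ : ℝ) (hρ : 0 < ρ)
    (γ : Fin m → ℝ) (hγ : ∀ i, γ i = 0 ∨ γ i = 1)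
    (z : Fin n → ℝ) (hz : ∀ i, |P i + z i| ≤ |P i|) :
    2 * specNorm (Matrix.diagonal γ * D * Eᵀ * E * D * Matrix.diagonal γ) +
        evnorm ((Matrix.diagonal γ * D * Eᵀ).mulVec (P + z)) ≤
      2 * specNorm (E * D) ^ 2 + specNorm (E * D) * evnorm P ∧
    ρ * specNorm E ^ 2 *
        (2 * specNorm (Matrix.diagonal γ * D * Eᵀ * E * D * Matrix.diagonal γ) +
          evnorm ((Matrix.diagonal γ * D * Eᵀ).mulVec (P + z))) ≤
      ρ * specNorm E ^ 2 * (2 * specNorm (E * D) ^ 2 + specNorm (E * D) * evnorm P) := by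
  have hγ' : ∀ i, |γ i| ≤ 1 := fun i => by rcases hγ i with h | h <;> simp [h]
  have hDt : Dᵀ = D := hD.isSymm
  have hR : Matrix.diagonal γ * D * Eᵀ = (E * D * Matrix.diagonal γ)ᵀ := by
    simp only [Matrix.transpose_mul, Matrix.diagonal_transpose, hDt, Matrix.mul_assoc]
  have hQ : Matrix.diagonal γ * D * Eᵀ * E * D * Matrix.diagonal γ =
      (E * D * Matrix.diagonal γ)ᵀ * (E * D * Matrix.diagonal γ) := by
    rw [← hR]
    simp only [Matrix.mul_assoc]
  have hW := specNorm_mul_diagonal_le (E * D) hγ'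
  have hQ_le : specNorm (Matrix.diagonal γ * D * Eᵀ * E * D * Matrix.diagonal γ) ≤
      specNorm (E * D) ^ 2 := by
    rw [hQ]
    refine (specNorm_mul_le _ _).trans ?_
    rw [specNorm_transpose, ← sq]
    exact pow_le_pow_left₀ (specNorm_nonneg _) hW 2
  have hR_le : evnorm ((Matrix.diagonal γ * D * Eᵀ).mulVec (P + z)) ≤
      specNorm (E * D) * evnorm P := by
    rw [hR]
    refine (evnorm_mulVec_le _ _).trans ?_
    rw [specNorm_transpose]
    exact mul_le_mul hW (evnorm_le_evnorm hz) (norm_nonneg _) (specNorm_nonneg _)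
  have hsum := add_le_add (mul_le_mul_of_nonneg_left hQ_le zero_le_two) hR_le
  exact ⟨hsum, mul_le_mul_of_nonneg_left hsum (by positivity)⟩
end

section
/- Let H be a real inner product space, let h : H → ℝ be differentiable with L-Lipschitz gradient (L > 0), let S ⊆ H be a nonempty set, let x ∈ S, let r > 1, and set a = r L and u = x − (1/a) ∇h(x). If x⁺ ∈ S satisfies ‖x⁺ − u‖ ≤ ‖y − u‖ for all y ∈ S (i.e., x⁺ minimizes the proximal objective over S), then h(x⁺) ≤ h(x) − ((r − 1) L / 2) ‖x⁺ − x‖². -/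
/-- The **descent lemma**: a function with `L`-Lipschitz gradient `g` lies below its quadratic
upper model at every point. -/
theorem le_add_inner_add_sq_of_lipschitz_gradient {H : Type*} [NormedAddCommGroup H]
    [InnerProductSpace ℝ H] [CompleteSpace H] {h : H → ℝ} {g : H → H} {L : ℝ}
    (hdiff : ∀ x, HasGradientAt h (g x) x)
    (hlip : ∀ x y, ‖g x - g y‖ ≤ L * ‖x - y‖) (x v : H) :
    h (x + v) ≤ h x + inner ℝ (g x) v + L / 2 * ‖v‖ ^ 2 := by
  have hf (t : ℝ) : HasDerivAt (fun s : ℝ => h (x + s • v)) (inner ℝ (g (x + t • v)) v) t := by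
    have hline : HasDerivAt (fun s : ℝ => x + s • v) v t := by
      simpa using ((hasDerivAt_id t).smul_const v).const_add x
    simpa [Function.comp_def] using (hdiff (x + t • v)).hasFDerivAt.comp_hasDerivAt t hline
  have hB (t : ℝ) : HasDerivAt
      (fun s : ℝ => h x + s * inner ℝ (g x) v + L / 2 * ‖v‖ ^ 2 * s ^ 2)
      (inner ℝ (g x) v + L * t * ‖v‖ ^ 2) t := by
    have hlin := ((hasDerivAt_id t).mul_const (inner ℝ (g x) v)).const_add (h x)
    have hsq := ((hasDerivAt_id t).pow 2).const_mul (L / 2 * ‖v‖ ^ 2)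
    refine (hlin.add hsq).congr_deriv ?_
    simp only [id, one_mul, mul_one]
    ring
  have hbound : ∀ t ∈ Set.Ico (0 : ℝ) 1,
      inner ℝ (g (x + t • v)) v ≤ inner ℝ (g x) v + L * t * ‖v‖ ^ 2 := by
    intro t ht
    have hg : ‖g (x + t • v) - g x‖ ≤ L * (t * ‖v‖) := by
      simpa [norm_smul, abs_of_nonneg ht.1] using hlip (x + t • v) x
    have hinner := real_inner_le_norm (g (x + t • v) - g x) v
    rw [inner_sub_left] at hinner
    nlinarith [mul_le_mul_of_nonneg_right hg (norm_nonneg v)]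
  have hle := image_le_of_deriv_right_le_deriv_boundary
    (fun t _ => (hf t).continuousAt.continuousWithinAt)
    (fun t _ => (hf t).hasDerivWithinAt) (by simp)
    (fun t _ => (hB t).continuousAt.continuousWithinAt)
    (fun t _ => (hB t).hasDerivWithinAt) hbound (Set.right_mem_Icc.2 zero_le_one)
  simpa using hle

/-- If a point is at least as close as `x` to the gradient step `x - a⁻¹ • w`, then its
displacement `v` from `x` satisfies `⟪w, v⟫ ≤ -(a / 2) ‖v‖²`. -/
theorem inner_le_neg_of_norm_add_smul_le {H : Type*} [NormedAddCommGroup H]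
    [InnerProductSpace ℝ H] {a : ℝ} (ha : 0 < a) {v w : H}
    (hle : ‖v + (1 / a) • w‖ ≤ ‖(1 / a) • w‖) :
    inner ℝ w v ≤ -(a / 2) * ‖v‖ ^ 2 := by
  have hsq := pow_le_pow_left₀ (norm_nonneg _) hle 2
  rw [norm_add_sq_real, real_inner_smul_right, real_inner_comm] at hsq
  have hmul : a * (‖v‖ ^ 2 + 2 * (1 / a * inner ℝ w v)) ≤ 0 :=
    mul_nonpos_of_nonneg_of_nonpos ha.le (by linarith)
  have hcancel : a * (1 / a) = 1 := mul_one_div_cancel ha.ne'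
  linear_combination hmul / 2 - inner ℝ w v * hcancel

/-- Sufficient decrease of a single proximal-linearization (PALM) step: if `h` has an
`L`-Lipschitz gradient `g`, `x ∈ S`, `r > 1`, `a = r L`, `u = x - (1/a) ∇h(x)`, and
`x⁺` minimizes `‖· - u‖` over `S`, then `h(x⁺) ≤ h(x) - ((r - 1) L / 2) ‖x⁺ - x‖²`. -/
theorem palm_step_sufficient_decrease {H : Type*} [NormedAddCommGroup H]
    [InnerProductSpace ℝ H] [CompleteSpace H] (h : H → ℝ) (g : H → H) (L : ℝ) (hL : 0 < L)
    (hdiff : ∀ x, HasGradientAt h (g x) x)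
    (hlip : ∀ x y, ‖g x - g y‖ ≤ L * ‖x - y‖)
    (S : Set H) (hS : S.Nonempty) (x : H) (hx : x ∈ S) (r : ℝ) (hr : 1 < r)
    (xplus : H) (hxplus : xplus ∈ S)
    (hmin : ∀ y ∈ S, ‖xplus - (x - (1 / (r * L)) • g x)‖ ≤ ‖y - (x - (1 / (r * L)) • g x)‖) :
    h xplus ≤ h x - (r - 1) * L / 2 * ‖xplus - x‖ ^ 2 := by
  have ha : 0 < r * L := mul_pos (zero_lt_one.trans hr) hL
  have hopt := inner_le_neg_of_norm_add_smul_le ha (v := xplus - x) (w := g x) (by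
    simpa [sub_sub_eq_add_sub, sub_add_eq_add_sub] using hmin x hx)
  have hdescent := le_add_inner_add_sq_of_lipschitz_gradient hdiff hlip x (xplus - x)
  rw [add_sub_cancel] at hdescent
  linarith
end

section
/- Consider one full PALM iteration applied to H_ρ: given (γ^k, z^k, θ^k) with γ^k ∈ G, z^k ∈ Z, θ^k ∈ T, suppose γ^{k+1} ∈ G minimizes ‖γ − u^k‖₂ over G with u^k = γ^k − (1/a_k)∇_γ H_ρ(γ^k, z^k, θ^k) and a_k = r₁ L₁, where L₁ > 0 is a Lipschitz constant of ∇_γ H_ρ(·, z^k, θ^k) and r₁ > 1; suppose z^{k+1} ∈ Z minimizes ‖z − v^k‖₂ over Z with v^k = z^k − (1/b_k)∇_z H_ρ(γ^{k+1}, z^k, θ^k) and b_k = r₂ L₂, where L₂ > 0 is a Lipschitz constant of ∇_z H_ρ(γ^{k+1}, ·, θ^k) and r₂ > 1; and suppose θ^{k+1} ∈ T minimizes ‖θ − w^k‖₂ over T with w^k = θ^k − (1/c_k)∇_θ H_ρ(γ^{k+1}, z^{k+1}, θ^k) and c_k = r₃ L₃, where L₃ > 0 is a Lipschitz constant of ∇_θ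 H_ρ(γ^{k+1}, z^{k+1}, ·) and r₃ > 1. Then H_ρ(γ^{k+1}, z^{k+1}, θ^{k+1}) ≤ H_ρ(γ^k, z^k, θ^k) − (d/2)(‖γ^{k+1} − γ^k‖₂² + ‖z^{k+1} − z^k‖₂² + ‖θ^{k+1} − θ^k‖₂²), where d = min{(r₁−1)L₁, (r₂−1)L₂, (r₃−1)L₃} > 0. -/
open scoped Matrix

/-- The penalized objective `H_ρ(γ, z, θ) = -cᵀz + (ρ/2)‖E D diag(γ) sin(Eᵀθ) - (P + z)‖₂²`. -/
noncomputable def Hpen {n m : ℕ} (E : Matrix (Fin n) (Fin m) ℝ) (D : Matrix (Fin m) (Fin m) ℝ)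
    (P c : Fin n → ℝ) (ρ : ℝ) (γ : Fin m → ℝ) (z θ : Fin n → ℝ) : ℝ :=
  -(∑ i, c i * z i) +
    ρ / 2 * ∑ i,
      ((E * D * Matrix.diagonal γ).mulVec (fun l => Real.sin (Eᵀ.mulVec θ l)) i - (P i + z i)) ^ 2

/-- `H_ρ` viewed as a function on Euclidean spaces. -/
noncomputable def HpenE {n m : ℕ} (E : Matrix (Fin n) (Fin m) ℝ) (D : Matrix (Fin m) (Fin m) ℝ)
    (P c : Fin n → ℝ) (ρ : ℝ) (γ : EuclideanSpace ℝ (Fin m))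
    (z θ : EuclideanSpace ℝ (Fin n)) : ℝ :=
  Hpen E D P c ρ ((WithLp.equiv 2 (Fin m → ℝ)) γ) ((WithLp.equiv 2 (Fin n → ℝ)) z)
    ((WithLp.equiv 2 (Fin n → ℝ)) θ)

section Descent

variable {F : Type*} [NormedAddCommGroup F] [InnerProductSpace ℝ F] [CompleteSpace F]

/-- The descent lemma: a differentiable function whose gradient is `L`-Lipschitz is bounded above
by its linearization plus `L / 2` times the squared distance. -/
theorem le_linearization_add_of_lipschitz_gradient {f : F → ℝ} (hf : Differentiable ℝ f) {L : ℝ}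
    (hlip : ∀ x y, ‖gradient f x - gradient f y‖ ≤ L * ‖x - y‖) (x y : F) :
    f y ≤ f x + inner ℝ (gradient f x) (y - x) + L / 2 * ‖y - x‖ ^ 2 := by
  set d := y - x with hd
  have hder (t : ℝ) : HasDerivAt
      (fun t : ℝ => f (x + t • d) - t * inner ℝ (gradient f x) d - L / 2 * ‖d‖ ^ 2 * t ^ 2)
      (inner ℝ (gradient f (x + t • d)) d - inner ℝ (gradient f x) d - L * ‖d‖ ^ 2 * t) t := by
    have hline : HasDerivAt (fun t : ℝ => x + t • d) d t := by
      simpa using ((hasDerivAt_id t).smul_const d).const_add x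
    have hcomp := (hf (x + t • d)).hasFDerivAt.comp_hasDerivAt t hline
    rw [← inner_gradient_left] at hcomp
    refine ((hcomp.sub ((hasDerivAt_id t).mul_const (inner ℝ (gradient f x) d))).sub
      ((hasDerivAt_pow 2 t).const_mul (L / 2 * ‖d‖ ^ 2))).congr_deriv ?_
    norm_num
    ring
  have hanti := antitoneOn_of_deriv_nonpos (convex_Icc (0 : ℝ) 1)
    (fun t _ => (hder t).continuousAt.continuousWithinAt)
    (fun t _ => (hder t).differentiableAt.differentiableWithinAt) (fun t ht => by
      rw [interior_Icc] at ht
      rw [(hder t).deriv, ← inner_sub_left]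
      have hinner := real_inner_le_norm (gradient f (x + t • d) - gradient f x) d
      have hgrad := hlip (x + t • d) x
      rw [add_sub_cancel_left, norm_smul, Real.norm_of_nonneg ht.1.le] at hgrad
      nlinarith [mul_le_mul_of_nonneg_right hgrad (norm_nonneg d)])
  have hle := hanti (Set.left_mem_Icc.2 zero_le_one) (Set.right_mem_Icc.2 zero_le_one) zero_le_one
  simp only [one_smul, zero_smul, add_zero, hd, add_sub_cancel] at hle
  linarith

/-- A point at least as close to the gradient step `x - a⁻¹ ∇f(x)` as `x` itself decreases `f` by
at least `(a - L) / 2` times the squared displacement. -/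
theorem le_sub_of_norm_sub_gradient_step_le {f : F → ℝ} (hf : Differentiable ℝ f) {L a : ℝ}
    (ha : 0 < a) (hlip : ∀ x y, ‖gradient f x - gradient f y‖ ≤ L * ‖x - y‖) {x y : F}
    (hmin : ‖y - (x - (1 / a) • gradient f x)‖ ≤ ‖x - (x - (1 / a) • gradient f x)‖) :
    f y ≤ f x - (a - L) / 2 * ‖y - x‖ ^ 2 := by
  have hdescent := le_linearization_add_of_lipschitz_gradient hf hlip x y
  have hsq := pow_le_pow_left₀ (norm_nonneg _) hmin 2
  rw [sub_sub_cancel, ← sub_add, norm_add_sq_real, real_inner_smul_right, real_inner_comm] at hsq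
  have hinner : ‖y - x‖ ^ 2 + 2 * (1 / a * inner ℝ (gradient f x) (y - x)) ≤ 0 := by linarith
  have hscaled := mul_nonpos_of_nonneg_of_nonpos ha.le hinner
  have hcancel : a * (‖y - x‖ ^ 2 + 2 * (1 / a * inner ℝ (gradient f x) (y - x))) =
      a * ‖y - x‖ ^ 2 + 2 * inner ℝ (gradient f x) (y - x) := by
    field_simp
  linarith

end Descent

theorem differentiable_HpenE {n m : ℕ} (E : Matrix (Fin n) (Fin m) ℝ)
    (D : Matrix (Fin m) (Fin m) ℝ) (P c : Fin n → ℝ) (ρ : ℝ) :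
    Differentiable ℝ (fun p : EuclideanSpace ℝ (Fin m) × EuclideanSpace ℝ (Fin n) ×
      EuclideanSpace ℝ (Fin n) => HpenE E D P c ρ p.1 p.2.1 p.2.2) := by
  simp only [HpenE, Hpen, WithLp.equiv_apply, Matrix.mulVec, dotProduct, Matrix.mul_diagonal]
  fun_prop

/-- Monotone decrease of the objective value along one full PALM iteration
(Proposition 1(3)): if each block update is a proximal-linearization step with stepsize
`1/(rᵢ Lᵢ)` (`rᵢ > 1`, `Lᵢ` a Lipschitz constant of the corresponding partial gradient),
then `H_ρ(γ^{k+1}, z^{k+1}, θ^{k+1}) ≤ H_ρ(γ^k, z^k, θ^k) - (d/2) ‖x^{k+1} - x^k‖²` with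
`d = min{(r₁-1)L₁, (r₂-1)L₂, (r₃-1)L₃}`. -/
theorem palm_iteration_decrease {n m : ℕ} (E : Matrix (Fin n) (Fin m) ℝ)
    (D : Matrix (Fin m) (Fin m) ℝ) (hD : D.IsDiag) (P c : Fin n → ℝ) (ρ : ℝ) (hρ : 0 < ρ)
    (G : Set (EuclideanSpace ℝ (Fin m))) (Z T : Set (EuclideanSpace ℝ (Fin n)))
    (γk γk1 : EuclideanSpace ℝ (Fin m)) (zk zk1 θk θk1 : EuclideanSpace ℝ (Fin n))
    (hγk : γk ∈ G) (hzk : zk ∈ Z) (hθk : θk ∈ T)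
    (hγk1 : γk1 ∈ G) (hzk1 : zk1 ∈ Z) (hθk1 : θk1 ∈ T)
    (L₁ L₂ L₃ r₁ r₂ r₃ : ℝ)
    (hL₁ : 0 < L₁) (hL₂ : 0 < L₂) (hL₃ : 0 < L₃)
    (hr₁ : 1 < r₁) (hr₂ : 1 < r₂) (hr₃ : 1 < r₃)
    (hlip₁ : ∀ γ₁ γ₂ : EuclideanSpace ℝ (Fin m),
      ‖gradient (fun γ' => HpenE E D P c ρ γ' zk θk) γ₁ -
          gradient (fun γ' => HpenE E D P c ρ γ' zk θk) γ₂‖ ≤ L₁ * ‖γ₁ - γ₂‖)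
    (hlip₂ : ∀ z₁ z₂ : EuclideanSpace ℝ (Fin n),
      ‖gradient (fun z' => HpenE E D P c ρ γk1 z' θk) z₁ -
          gradient (fun z' => HpenE E D P c ρ γk1 z' θk) z₂‖ ≤ L₂ * ‖z₁ - z₂‖)
    (hlip₃ : ∀ θ₁ θ₂ : EuclideanSpace ℝ (Fin n),
      ‖gradient (fun θ' => HpenE E D P c ρ γk1 zk1 θ') θ₁ -
          gradient (fun θ' => HpenE E D P c ρ γk1 zk1 θ') θ₂‖ ≤ L₃ * ‖θ₁ - θ₂‖)
    (hmin₁ : ∀ γ ∈ G,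
      ‖γk1 - (γk - (1 / (r₁ * L₁)) • gradient (fun γ' => HpenE E D P c ρ γ' zk θk) γk)‖ ≤
        ‖γ - (γk - (1 / (r₁ * L₁)) • gradient (fun γ' => HpenE E D P c ρ γ' zk θk) γk)‖)
    (hmin₂ : ∀ z ∈ Z,
      ‖zk1 - (zk - (1 / (r₂ * L₂)) • gradient (fun z' => HpenE E D P c ρ γk1 z' θk) zk)‖ ≤
        ‖z - (zk - (1 / (r₂ * L₂)) • gradient (fun z' => HpenE E D P c ρ γk1 z' θk) zk)‖)
    (hmin₃ : ∀ θ ∈ T,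
      ‖θk1 - (θk - (1 / (r₃ * L₃)) • gradient (fun θ' => HpenE E D P c ρ γk1 zk1 θ') θk)‖ ≤
        ‖θ - (θk - (1 / (r₃ * L₃)) • gradient (fun θ' => HpenE E D P c ρ γk1 zk1 θ') θk)‖) :
    HpenE E D P c ρ γk1 zk1 θk1 ≤
      HpenE E D P c ρ γk zk θk -
        min (min ((r₁ - 1) * L₁) ((r₂ - 1) * L₂)) ((r₃ - 1) * L₃) / 2 *
          (‖γk1 - γk‖ ^ 2 + ‖zk1 - zk‖ ^ 2 + ‖θk1 - θk‖ ^ 2) := by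
  have hdiff := differentiable_HpenE E D P c ρ
  have hγ := le_sub_of_norm_sub_gradient_step_le (f := fun γ' => HpenE E D P c ρ γ' zk θk)
    (hdiff.comp (by fun_prop : Differentiable ℝ fun γ' => (γ', zk, θk)))
    (by positivity) hlip₁ (hmin₁ γk hγk)
  have hz := le_sub_of_norm_sub_gradient_step_le (f := fun z' => HpenE E D P c ρ γk1 z' θk)
    (hdiff.comp (by fun_prop : Differentiable ℝ fun z' => (γk1, z', θk)))
    (by positivity) hlip₂ (hmin₂ zk hzk)
  have hθ := le_sub_of_norm_sub_gradient_step_le (f := fun θ' => HpenE E D P c ρ γk1 zk1 θ')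
    (hdiff.comp (by fun_prop : Differentiable ℝ fun θ' => (γk1, zk1, θ')))
    (by positivity) hlip₃ (hmin₃ θk hθk)
  set d := min (min ((r₁ - 1) * L₁) ((r₂ - 1) * L₂)) ((r₃ - 1) * L₃)
  have hd₁ : d ≤ (r₁ - 1) * L₁ := (min_le_left _ _).trans (min_le_left _ _)
  have hd₂ : d ≤ (r₂ - 1) * L₂ := (min_le_left _ _).trans (min_le_right _ _)
  have hd₃ : d ≤ (r₃ - 1) * L₃ := min_le_right _ _
  have hdγ := mul_le_mul_of_nonneg_right hd₁ (sq_nonneg ‖γk1 - γk‖)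
  have hdz := mul_le_mul_of_nonneg_right hd₂ (sq_nonneg ‖zk1 - zk‖)
  have hdθ := mul_le_mul_of_nonneg_right hd₃ (sq_nonneg ‖θk1 - θk‖)
  linarith
end
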